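/- Consider the bow-tie query Q_⋈ = R(X) ⋈ S(X, Y) ⋈ T(Y) with GAO (X, Y), let C be a certificate for a given instance, and let t = (x, y) be a tuple that is not an output tuple. Let i_R^ℓ be the largest index with R[i_R^ℓ] ≤ x and i_R^h the smallest index with R[i_R^h] ≥ x (with conventions R[0] = −∞ and R[|R|+1] = +∞); define (i_T^ℓ, i_T^h) analogously around y in T, (i_S^ℓ, i_S^h) around x among the X-values of S, (i_S^{ℓℓ}, i_S^{ℓh}) around y among the Y-values S[i_S^ℓ, *], and (i_S^{hℓ}, i_S^{hh}) around y among S[i_S^h, *]. Call a variable among R[i_R^h], R[i_R^ℓ], S[i_S^h], S[i_S^ℓ] t-alignable if it is in range and either equals x or occurs in no comparison of C; call T[i_T^h], T[i_T^ℓ] t-alignable if in range and either equal to y or occurring in no comparison of C; call S[i_S^h, i_S^{hℓ}] and S[i_S^h, i_S^{hh}] t-alignable if S[i_S^h] is t-alignable and the variable itself is in range and either equals y or occurs in no comparison of C, and analogously for S[i_S^ℓ, i_S^{ℓℓ}] and S[i_S^ℓ, i_S^{ℓh}]. Then at least one of the following five cases holds: (1) both R[i_R^h] and R[i_R^ℓ]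 are not t-alignable; (2) both S[i_S^h] and S[i_S^ℓ] are not t-alignable; (3) both S[i_S^h, i_S^{hℓ}] and S[i_S^h, i_S^{hh}] are not t-alignable; (4) both S[i_S^ℓ, i_S^{ℓℓ}] and S[i_S^ℓ, i_S^{ℓh}] are not t-alignable; (5) both T[i_T^h] and T[i_T^ℓ] are not t-alignable. -/

import Mathlib

/-- Comparisons allowed for the bow-tie query `R(X) ⋈ S(X,Y) ⋈ T(Y)`:
`R[i] θ S[i']` (on `X`-values), `S[i,j] θ T[j']` (on `Y`-values), and
`S[i,j] θ S[i',j']` (on `Y`-values). -/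
inductive BComp where
  | rs (i i' : ℕ) (o : Ordering)
  | st (i j j' : ℕ) (o : Ordering)
  | ss (i j i' j' : ℕ) (o : Ordering)
deriving DecidableEq

/-- An instance of the bow-tie query: `R` and `T` are (one-level) sorted lists,
`SX` is the sorted list of `X`-values of `S` and `SY i` the sorted list of `Y`-values of `S`
below the `i`-th `X`-value.  All positions are `1`-based. -/
structure BInst where
  R : ℕ → ℕ
  T : ℕ → ℕ
  SX : ℕ → ℕ
  SY : ℕ → ℕ → ℕ

/-- The sizes of the (index structure of an) instance of the bow-tie query. -/
structure BSizes where
  NR : ℕ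
  NT : ℕ
  NS : ℕ
  nS : ℕ → ℕ

/-- `f` is strictly increasing on positions `1, …, N`. -/
def StrictOn (f : ℕ → ℕ) (N : ℕ) : Prop :=
  ∀ j k : ℕ, 1 ≤ j → j < k → k ≤ N → f j < f k

/-- `I` is a valid instance for the sizes `z`. -/
def IsBInst (z : BSizes) (I : BInst) : Prop :=
  StrictOn I.R z.NR ∧ StrictOn I.T z.NT ∧ StrictOn I.SX z.NS ∧
  ∀ i, 1 ≤ i → i ≤ z.NS → StrictOn (I.SY i) (z.nS i)

/-- The instance `I` satisfies the comparison. -/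
def BSat (I : BInst) : BComp → Prop
  | .rs i i' o => compare (I.R i) (I.SX i') = o
  | .st i j j' o => compare (I.SY i j) (I.T j') = o
  | .ss i j i' j' o => compare (I.SY i j) (I.SY i' j') = o

/-- Well-formedness of a comparison: all indices in range. -/
def BCompWF (z : BSizes) : BComp → Prop
  | .rs i i' _ => 1 ≤ i ∧ i ≤ z.NR ∧ 1 ≤ i' ∧ i' ≤ z.NS
  | .st i j j' _ => 1 ≤ i ∧ i ≤ z.NS ∧ 1 ≤ j ∧ j ≤ z.nS i ∧ 1 ≤ j' ∧ j' ≤ z.NT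
  | .ss i j i' j' _ =>
      1 ≤ i ∧ i ≤ z.NS ∧ 1 ≤ j ∧ j ≤ z.nS i ∧ 1 ≤ i' ∧ i' ≤ z.NS ∧ 1 ≤ j' ∧ j' ≤ z.nS i'

/-- A witness `{i, (j,k), ℓ}`: in-range index tuples with `R[i] = S[j]` and `S[j,k] = T[ℓ]`. -/
def BWitness (z : BSizes) (I : BInst) (w : ℕ × (ℕ × ℕ) × ℕ) : Prop :=
  1 ≤ w.1 ∧ w.1 ≤ z.NR ∧ 1 ≤ w.2.1.1 ∧ w.2.1.1 ≤ z.NS ∧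
  1 ≤ w.2.1.2 ∧ w.2.1.2 ≤ z.nS w.2.1.1 ∧ 1 ≤ w.2.2 ∧ w.2.2 ≤ z.NT ∧
  I.R w.1 = I.SX w.2.1.1 ∧ I.SY w.2.1.1 w.2.1.2 = I.T w.2.2

/-- `C` is a certificate (for the index structure `z`): any two instances satisfying all
comparisons in `C` have exactly the same witnesses. -/
def BIsCert (z : BSizes) (C : Finset BComp) : Prop :=
  (∀ c ∈ C, BCompWF z c) ∧
  ∀ I I', IsBInst z I → IsBInst z I' → (∀ c ∈ C, BSat I c) → (∀ c ∈ C, BSat I' c) →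
    ∀ w, BWitness z I w ↔ BWitness z I' w

/-- `R[i]` occurs in a comparison of `C`. -/
def OccR (C : Finset BComp) (i : ℕ) : Prop :=
  ∃ c ∈ C, match c with | .rs i₀ _ _ => i₀ = i | _ => False

/-- `S[i']` (an `X`-variable of `S`) occurs in a comparison of `C`. -/
def OccSX (C : Finset BComp) (i' : ℕ) : Prop :=
  ∃ c ∈ C, match c with | .rs _ i₀ _ => i₀ = i' | _ => False

/-- `S[i,j]` (a `Y`-variable of `S`) occurs in a comparison of `C`. -/
def OccSY (C : Finset BComp) (i j : ℕ) : Prop :=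
  ∃ c ∈ C, match c with
    | .st i₀ j₀ _ _ => i₀ = i ∧ j₀ = j
    | .ss i₀ j₀ i₁ j₁ _ => (i₀ = i ∧ j₀ = j) ∨ (i₁ = i ∧ j₁ = j)
    | _ => False

/-- `T[j']` occurs in a comparison of `C`. -/
def OccT (C : Finset BComp) (j' : ℕ) : Prop :=
  ∃ c ∈ C, match c with | .st _ _ j₀ _ => j₀ = j' | _ => False

/-- `R[idx]` is `t`-alignable (for `t = (x,y)`). -/
def AlignR (z : BSizes) (I : BInst) (C : Finset BComp) (x idx : ℕ) : Prop :=
  1 ≤ idx ∧ idx ≤ z.NR ∧ (I.R idx = x ∨ ¬ OccR C idx)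

/-- `S[idx]` is `t`-alignable (for `t = (x,y)`). -/
def AlignSX (z : BSizes) (I : BInst) (C : Finset BComp) (x idx : ℕ) : Prop :=
  1 ≤ idx ∧ idx ≤ z.NS ∧ (I.SX idx = x ∨ ¬ OccSX C idx)

/-- `T[idx]` is `t`-alignable (for `t = (x,y)`). -/
def AlignT (z : BSizes) (I : BInst) (C : Finset BComp) (y idx : ℕ) : Prop :=
  1 ≤ idx ∧ idx ≤ z.NT ∧ (I.T idx = y ∨ ¬ OccT C idx)

/-- `S[pidx, idx]` is `t`-alignable (for `t = (x,y)`): its parent `S[pidx]` is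
`t`-alignable and it is in range and equals `y` or occurs in no comparison of `C`. -/
def AlignSY (z : BSizes) (I : BInst) (C : Finset BComp) (x y pidx idx : ℕ) : Prop :=
  AlignSX z I C x pidx ∧ 1 ≤ idx ∧ idx ≤ z.nS pidx ∧
    (I.SY pidx idx = y ∨ ¬ OccSY C pidx idx)

/-- `lo` is the largest position (possibly `0`, standing for `-∞`) with `f lo ≤ v`, and
`hi` the smallest position (possibly `N+1`, standing for `+∞`) with `v ≤ f hi`, among
positions `1, …, N`. -/
def GlbLub (f : ℕ → ℕ) (N v lo hi : ℕ) : Prop :=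
  lo ≤ N ∧ (1 ≤ lo → f lo ≤ v) ∧ (∀ j, lo < j → j ≤ N → v < f j) ∧
  1 ≤ hi ∧ hi ≤ N + 1 ∧ (hi ≤ N → v ≤ f hi) ∧ (∀ j, 1 ≤ j → j < hi → f j < v)

/-- Moving a boundary variable around `v` to the value `v` keeps the sequence increasing. -/
lemma StrictOn.update_boundary {f : ℕ → ℕ} {N v lo hi i : ℕ} (hf : StrictOn f N)
    (hg : GlbLub f N v lo hi) (hi' : i = hi ∨ i = lo) :
    StrictOn (Function.update f i v) N := by
  obtain ⟨-, hlo, hlo', -, -, hhi, hhi'⟩ := hg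
  intro j k hj hjk hk
  have hfjk := hf j k hj hjk hk
  by_cases h1 : j = i
  · have h2 : k ≠ i := by omega
    subst h1
    rw [Function.update_self, Function.update_of_ne h2]
    rcases hi' with h | h
    · have := hhi (by omega)
      subst h
      omega
    · exact hlo' k (by omega) hk
  · rw [Function.update_of_ne h1]
    by_cases h2 : k = i
    · subst h2
      rw [Function.update_self]
      rcases hi' with h | h
      · exact hhi' j hj (by omega)
      · have := hlo (by omega)
        subst h
        omega
    · rwa [Function.update_of_ne h2]

lemma StrictOn.two_mul {f : ℕ → ℕ} {N : ℕ} (hf : StrictOn f N) :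
    StrictOn (fun j => 2 * f j) N := fun j k hj hjk hk => by
  have := hf j k hj hjk hk
  dsimp only
  omega

/-- After doubling all values, a single one can be increased by one. -/
lemma StrictOn.update_two_mul {f : ℕ → ℕ} {N : ℕ} (hf : StrictOn f N) (i : ℕ) :
    StrictOn (Function.update (fun j => 2 * f j) i (2 * f i + 1)) N := by
  intro j k hj hjk hk
  have := hf j k hj hjk hk
  simp only [Function.update_apply]
  split_ifs <;> subst_vars <;> omega

/-- A comparison survives when the variables occurring in `C` are transformed by strictly
monotone maps, whatever happens to the other variables. -/
lemma BSat.of_strictMono {C : Finset BComp} {I I' : BInst} {a b : ℕ → ℕ}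
    (ha : StrictMono a) (hb : StrictMono b)
    (hR : ∀ i, OccR C i → I'.R i = a (I.R i))
    (hSX : ∀ i, OccSX C i → I'.SX i = a (I.SX i))
    (hSY : ∀ i j, OccSY C i j → I'.SY i j = b (I.SY i j))
    (hT : ∀ j, OccT C j → I'.T j = b (I.T j))
    {c : BComp} (hc : c ∈ C) (h : BSat I c) : BSat I' c := by
  have key {g : ℕ → ℕ} (hg : StrictMono g) (m n : ℕ) :
      compare (g m) (g n) = compare m n := by
    rw [← cmp_eq_compare, ← cmp_eq_compare, hg.cmp_map_eq]
  cases c with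
  | rs i i' o =>
    simp only [BSat] at h ⊢
    rw [hR i ⟨_, hc, rfl⟩, hSX i' ⟨_, hc, rfl⟩, key ha, h]
  | st i j j' o =>
    simp only [BSat] at h ⊢
    rw [hSY i j ⟨_, hc, rfl, rfl⟩, hT j' ⟨_, hc, rfl⟩, key hb, h]
  | ss i j i' j' o =>
    simp only [BSat] at h ⊢
    rw [hSY i j ⟨_, hc, Or.inl ⟨rfl, rfl⟩⟩, hSY i' j' ⟨_, hc, Or.inr ⟨rfl, rfl⟩⟩, key hb, h]

/-- A witness of a certified instance has its `R`-variable in some comparison. -/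
lemma BWitness.occR {z : BSizes} {I : BInst} {C : Finset BComp} {r s k l : ℕ}
    (hw : BWitness z I (r, (s, k), l)) (hI : IsBInst z I) (hC : BIsCert z C)
    (hs : ∀ c ∈ C, BSat I c) : OccR C r := by
  by_contra hocc
  obtain ⟨hIR, hIT, hIX, hIY⟩ := hI
  let I' : BInst :=
    ⟨Function.update (fun j => 2 * I.R j) r (2 * I.R r + 1), I.T, fun j => 2 * I.SX j, I.SY⟩
  have hsat : ∀ c ∈ C, BSat I' c := fun c hc =>
    BSat.of_strictMono (I := I) (I' := I') (a := fun v => 2 * v) (b := id)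
      (fun _ _ h => by dsimp only; omega) strictMono_id
      (fun i hi => Function.update_of_ne (fun h : i = r => hocc (h ▸ hi)) _
        (fun j => 2 * I.R j))
      (fun _ _ => rfl) (fun _ _ _ => rfl) (fun _ _ => rfl) hc (hs c hc)
  have hw' := (hC.2 I I' ⟨hIR, hIT, hIX, hIY⟩
    ⟨hIR.update_two_mul r, hIT, hIX.two_mul, hIY⟩ hs hsat _).1 hw
  have heq : I'.R r = I'.SX s := hw'.2.2.2.2.2.2.2.2.1
  simp only [I', Function.update_self] at heq
  omega

/-- A witness of a certified instance has its `T`-variable in some comparison. -/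
lemma BWitness.occT {z : BSizes} {I : BInst} {C : Finset BComp} {r s k l : ℕ}
    (hw : BWitness z I (r, (s, k), l)) (hI : IsBInst z I) (hC : BIsCert z C)
    (hs : ∀ c ∈ C, BSat I c) : OccT C l := by
  by_contra hocc
  obtain ⟨hIR, hIT, hIX, hIY⟩ := hI
  let I' : BInst :=
    ⟨I.R, Function.update (fun j => 2 * I.T j) l (2 * I.T l + 1), I.SX, fun i j => 2 * I.SY i j⟩
  have hsat : ∀ c ∈ C, BSat I' c := fun c hc =>
    BSat.of_strictMono (I := I) (I' := I') (a := id) (b := fun v => 2 * v) strictMono_id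
      (fun _ _ h => by dsimp only; omega)
      (fun _ _ => rfl) (fun _ _ => rfl) (fun _ _ _ => rfl)
      (fun i hi => Function.update_of_ne (fun h : i = l => hocc (h ▸ hi)) _
        (fun j => 2 * I.T j)) hc (hs c hc)
  have hw' := (hC.2 I I' ⟨hIR, hIT, hIX, hIY⟩
    ⟨hIR, hIT.update_two_mul l, hIX, fun i h1 h2 => (hIY i h1 h2).two_mul⟩ hs hsat _).1 hw
  have heq : I'.SY s k = I'.T l := hw'.2.2.2.2.2.2.2.2.2
  simp only [I', Function.update_self] at heq
  omega

lemma update_eq_of_eq_or_not {P : ℕ → Prop} {f : ℕ → ℕ} {i v : ℕ} (h : f i = v ∨ ¬ P i)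
    (j : ℕ) (hj : P j) : Function.update f i v j = f j := by
  rcases eq_or_ne j i with rfl | hne
  · rcases h with h | h
    · rw [Function.update_self, h]
    · exact absurd hj h
  · exact Function.update_of_ne hne _ _

/-- For the bow-tie query, if `C` certifies the instance `I` and `t = (x,y)` is not an
output tuple, then one of the five pairs of boundary variables around `t` consists of two
non-`t`-alignable variables. -/
theorem stmt_13 (z : BSizes) (I : BInst) (hI : IsBInst z I) (C : Finset BComp)
    (hC : BIsCert z C) (hs : ∀ c ∈ C, BSat I c) (x y : ℕ)
    (hout : ¬ ((∃ i, 1 ≤ i ∧ i ≤ z.NR ∧ I.R i = x) ∧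
        (∃ j k, 1 ≤ j ∧ j ≤ z.NS ∧ 1 ≤ k ∧ k ≤ z.nS j ∧ I.SX j = x ∧ I.SY j k = y) ∧
        (∃ l, 1 ≤ l ∧ l ≤ z.NT ∧ I.T l = y)))
    (iRl iRh iTl iTh iSl iSh iSll iSlh iShl iShh : ℕ)
    (hRg : GlbLub I.R z.NR x iRl iRh)
    (hTg : GlbLub I.T z.NT y iTl iTh)
    (hSXg : GlbLub I.SX z.NS x iSl iSh)
    (hSYl : 1 ≤ iSl → GlbLub (I.SY iSl) (z.nS iSl) y iSll iSlh)
    (hSYh : iSh ≤ z.NS → GlbLub (I.SY iSh) (z.nS iSh) y iShl iShh) :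
    (¬ AlignR z I C x iRh ∧ ¬ AlignR z I C x iRl) ∨
    (¬ AlignSX z I C x iSh ∧ ¬ AlignSX z I C x iSl) ∨
    (¬ AlignSY z I C x y iSh iShl ∧ ¬ AlignSY z I C x y iSh iShh) ∨
    (¬ AlignSY z I C x y iSl iSll ∧ ¬ AlignSY z I C x y iSl iSlh) ∨
    (¬ AlignT z I C y iTh ∧ ¬ AlignT z I C y iTl) := by
  by_contra hcon
  have pick {p : ℕ → Prop} {a b : ℕ} (h : ¬ (¬ p a ∧ ¬ p b)) : ∃ i, (i = a ∨ i = b) ∧ p i := by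
    by_cases ha : p a
    · exact ⟨a, Or.inl rfl, ha⟩
    · exact ⟨b, Or.inr rfl, not_not.1 fun hb => h ⟨ha, hb⟩⟩
  simp only [not_or] at hcon
  obtain ⟨hR, -, hY, -, hT⟩ := hcon
  obtain ⟨r, hr, hr1, hr2, hrx⟩ := pick (p := AlignR z I C x) hR
  obtain ⟨l, hl, hl1, hl2, hly⟩ := pick (p := AlignT z I C y) hT
  obtain ⟨k, hk, ⟨hs1, hs2, hsx⟩, hk1, hk2, hky⟩ :=
    pick (p := AlignSY z I C x y iSh) (a := iShl) (b := iShh) hY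
  have ⟨hIR, hIT, hIX, hIY⟩ := hI
  let I' : BInst :=
    ⟨Function.update I.R r x, Function.update I.T l y, Function.update I.SX iSh x,
      Function.update I.SY iSh (Function.update (I.SY iSh) k y)⟩
  have hI' : IsBInst z I' := by
    refine ⟨hIR.update_boundary hRg hr, hIT.update_boundary hTg hl,
      hIX.update_boundary hSXg (Or.inl rfl), fun i h1 h2 => ?_⟩
    rcases eq_or_ne i iSh with rfl | hne
    · simpa only [I', Function.update_self] using
        (hIY i h1 h2).update_boundary (hSYh h2) hk.symm
    · simpa only [I', Function.update_of_ne hne] using hIY i h1 h2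
  have hsat : ∀ c ∈ C, BSat I' c := fun c hc => by
    refine BSat.of_strictMono (I := I) (I' := I') strictMono_id strictMono_id
      (update_eq_of_eq_or_not hrx) (update_eq_of_eq_or_not hsx) (fun i j hij => ?_)
      (update_eq_of_eq_or_not hly) hc (hs c hc)
    rcases eq_or_ne i iSh with rfl | hne
    · simpa only [I', Function.update_self, id] using
        update_eq_of_eq_or_not (P := OccSY C i) hky j hij
    · simp only [I', Function.update_of_ne hne, id]
  have hw' : BWitness z I' (r, (iSh, k), l) :=
    ⟨hr1, hr2, hs1, hs2, hk1, hk2, hl1, hl2, by simp [I'], by simp [I']⟩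
  have hw := (hC.2 I I' hI hI' hs hsat _).2 hw'
  have hRx : I.R r = x := hrx.resolve_right (not_not.2 (hw.occR hI hC hs))
  have hTy : I.T l = y := hly.resolve_right (not_not.2 (hw.occT hI hC hs))
  have hRS : I.R r = I.SX iSh := hw.2.2.2.2.2.2.2.2.1
  have hST : I.SY iSh k = I.T l := hw.2.2.2.2.2.2.2.2.2
  exact hout ⟨⟨r, hr1, hr2, hRx⟩,
    ⟨iSh, k, hs1, hs2, hk1, hk2, hRS.symm.trans hRx, hST.trans hTy⟩, ⟨l, hl1, hl2, hTy⟩⟩
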